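/- Let X be a projective variety over an algebraically closed field K, φ: X → X a morphism, and L a line bundle on X such that φ*(L) ⊗ L^{−1} is ample. Then for every positive integer n, the set of points x ∈ X(K) with φ^n(x) = x is finite; that is, the intersection of the diagonal Δ_X with the graph Γ_{φ^n} of φ^n in X × X has finitely many K-points. -/

import Mathlib

open AlgebraicGeometry CategoryTheory CategoryTheory.Limits Opposite

noncomputable section

universe u

/-- Restriction of sections of the structure sheaf, as a ring homomorphism. -/
def sres (X : Scheme.{u}) {V W : X.Opens} (h : V ≤ W) : Γ(X, W) →+* Γ(X, V) :=
  (X.presheaf.map (homOfLE h).op : Γ(X, W) ⟶ Γ(X, V)).hom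

lemma sres_sres (X : Scheme.{u}) {V W T : X.Opens} (h₁ : V ≤ W) (h₂ : W ≤ T) (a : Γ(X, T)) :
    sres X h₁ (sres X h₂ a) = sres X (h₁.trans h₂) a := by
  have : (homOfLE (h₁.trans h₂)).op = (homOfLE h₂).op ≫ (homOfLE h₁).op := rfl
  simp only [sres, this, Functor.map_comp]
  rfl

/-- A line bundle (invertible sheaf) on a scheme `X`, presented by an open cover and a
Čech `1`-cocycle of transition units. -/
structure LineBundle (X : Scheme.{u}) where
  ι : Type u
  U : ι → X.Opens
  covers : iSup U = ⊤
  t : ∀ i j, (Γ(X, U i ⊓ U j))ˣ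
  cocycle : ∀ i j l,
    Units.map (sres X (show U i ⊓ U j ⊓ U l ≤ U i ⊓ U j from inf_le_left)).toMonoidHom (t i j)
      * Units.map (sres X (show U i ⊓ U j ⊓ U l ≤ U j ⊓ U l from
          le_inf (inf_le_left.trans inf_le_right) inf_le_right)).toMonoidHom (t j l)
    = Units.map (sres X (show U i ⊓ U j ⊓ U l ≤ U i ⊓ U l from
          le_inf (inf_le_left.trans inf_le_left) inf_le_right)).toMonoidHom (t i l)

namespace LineBundle

variable {X Y : Scheme.{u}}

/-- The `n`-th tensor power of a line bundle. -/
def pow (L : LineBundle X) (n : ℕ) : LineBundle X where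
  ι := L.ι
  U := L.U
  covers := L.covers
  t i j := L.t i j ^ n
  cocycle i j l := by
    simp only [map_pow, ← mul_pow, L.cocycle i j l]

/-- The dual (inverse) of a line bundle. -/
def dual (L : LineBundle X) : LineBundle X where
  ι := L.ι
  U := L.U
  covers := L.covers
  t i j := (L.t i j)⁻¹
  cocycle i j l := by
    simp only [map_inv, ← mul_inv, L.cocycle i j l]

/-- The trivial line bundle. -/
def trivial (X : Scheme.{u}) : LineBundle X where
  ι := PUnit
  U _ := ⊤
  covers := by simp
  t _ _ := 1
  cocycle _ _ _ := by simp

lemma unit_sres_sres (X : Scheme.{u}) {V W T : X.Opens} (h₁ : V ≤ W) (h₂ : W ≤ T)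
    (u : (Γ(X, T))ˣ) :
    Units.map (sres X h₁).toMonoidHom (Units.map (sres X h₂).toMonoidHom u)
      = Units.map (sres X (h₁.trans h₂)).toMonoidHom u := by
  ext
  exact sres_sres X h₁ h₂ u

/-- The tensor product of two line bundles. -/
def tensor (L M : LineBundle X) : LineBundle X where
  ι := L.ι × M.ι
  U p := L.U p.1 ⊓ M.U p.2
  covers := by
    apply le_antisymm le_top
    have h : (⊤ : X.Opens) = (⨆ i, L.U i) ⊓ ⨆ j, M.U j := by
      rw [L.covers, M.covers, top_inf_eq]
    rw [h, iSup_inf_eq]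
    refine iSup_le fun i => ?_
    rw [inf_iSup_eq]
    exact iSup_le fun j => le_iSup_of_le (i, j) le_rfl
  t p q :=
    Units.map (sres X (show (L.U p.1 ⊓ M.U p.2) ⊓ (L.U q.1 ⊓ M.U q.2) ≤ L.U p.1 ⊓ L.U q.1 from
        le_inf (inf_le_left.trans inf_le_left) (inf_le_right.trans inf_le_left))).toMonoidHom
      (L.t p.1 q.1) *
    Units.map (sres X (show (L.U p.1 ⊓ M.U p.2) ⊓ (L.U q.1 ⊓ M.U q.2) ≤ M.U p.2 ⊓ M.U q.2 from
        le_inf (inf_le_left.trans inf_le_right) (inf_le_right.trans inf_le_right))).toMonoidHom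
      (M.t p.2 q.2)
  cocycle p q r := by
    simp only [map_mul, unit_sres_sres]
    have hL := congrArg (Units.map (sres X (show
        (L.U p.1 ⊓ M.U p.2) ⊓ (L.U q.1 ⊓ M.U q.2) ⊓ (L.U r.1 ⊓ M.U r.2) ≤
          L.U p.1 ⊓ L.U q.1 ⊓ L.U r.1 from
        le_inf (le_inf (inf_le_left.trans (inf_le_left.trans inf_le_left))
          (inf_le_left.trans (inf_le_right.trans inf_le_left)))
          (inf_le_right.trans inf_le_left))).toMonoidHom) (L.cocycle p.1 q.1 r.1)
    have hM := congrArg (Units.map (sres X (show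
        (L.U p.1 ⊓ M.U p.2) ⊓ (L.U q.1 ⊓ M.U q.2) ⊓ (L.U r.1 ⊓ M.U r.2) ≤
          M.U p.2 ⊓ M.U q.2 ⊓ M.U r.2 from
        le_inf (le_inf (inf_le_left.trans (inf_le_left.trans inf_le_right))
          (inf_le_left.trans (inf_le_right.trans inf_le_right)))
          (inf_le_right.trans inf_le_right))).toMonoidHom) (M.cocycle p.2 q.2 r.2)
    simp only [map_mul, unit_sres_sres] at hL hM
    rw [mul_mul_mul_comm, hL, hM]

lemma preimage_mono (f : X ⟶ Y) {U U' : Y.Opens} (h : U ≤ U') : f ⁻¹ᵁ U ≤ f ⁻¹ᵁ U' :=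
  fun _ hx => h hx

lemma unit_sres_appLE (f : X ⟶ Y) {U : Y.Opens} {V V' : X.Opens} (e : V ≤ f ⁻¹ᵁ U)
    (h : V' ≤ V) (u : (Γ(Y, U))ˣ) :
    Units.map (sres X h).toMonoidHom (Units.map (f.appLE U V e).hom.toMonoidHom u)
      = Units.map (f.appLE U V' (h.trans e)).hom.toMonoidHom u := by
  ext
  show sres X h (f.appLE U V e u) = f.appLE U V' (h.trans e) u
  rw [show f.appLE U V' (h.trans e)
      = f.appLE U V e ≫ X.presheaf.map (homOfLE h).op from (f.appLE_map e (homOfLE h).op).symm]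
  rfl

lemma unit_appLE_sres (f : X ⟶ Y) {U U' : Y.Opens} {V : X.Opens} (e : V ≤ f ⁻¹ᵁ U)
    (h : U ≤ U') (u : (Γ(Y, U'))ˣ) :
    Units.map (f.appLE U V e).hom.toMonoidHom (Units.map (sres Y h).toMonoidHom u)
      = Units.map (f.appLE U' V (e.trans (preimage_mono f h))).hom.toMonoidHom u := by
  ext
  show f.appLE U V e (sres Y h u) = f.appLE U' V _ u
  rw [show f.appLE U' V (e.trans (preimage_mono f h))
      = Y.presheaf.map (homOfLE h).op ≫ f.appLE U V e from (f.map_appLE e (homOfLE h).op).symm]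
  rfl

lemma preimage_inf (f : X ⟶ Y) (U V : Y.Opens) :
    f ⁻¹ᵁ (U ⊓ V) = f ⁻¹ᵁ U ⊓ f ⁻¹ᵁ V := by
  ext x; simp

set_option maxHeartbeats 1000000 in
/-- The pullback of a line bundle along a morphism of schemes. -/
def pullbackLB (f : X ⟶ Y) (L : LineBundle Y) : LineBundle X where
  ι := L.ι
  U i := f ⁻¹ᵁ L.U i
  covers := by
    have : (⨆ i, f ⁻¹ᵁ L.U i) = f ⁻¹ᵁ (⨆ i, L.U i) := by
      ext x
      simp [TopologicalSpace.Opens.mem_iSup]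
    rw [this, L.covers]
    rfl
  t i j :=
    Units.map (f.appLE (L.U i ⊓ L.U j) (f ⁻¹ᵁ L.U i ⊓ f ⁻¹ᵁ L.U j)
      (preimage_inf f (L.U i) (L.U j)).ge).hom.toMonoidHom (L.t i j)
  cocycle i j l := by
    have key := congrArg (Units.map (f.appLE (L.U i ⊓ L.U j ⊓ L.U l)
        (f ⁻¹ᵁ L.U i ⊓ f ⁻¹ᵁ L.U j ⊓ f ⁻¹ᵁ L.U l)
        (le_of_eq (show f ⁻¹ᵁ L.U i ⊓ f ⁻¹ᵁ L.U j ⊓ f ⁻¹ᵁ L.U l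
            = f ⁻¹ᵁ (L.U i ⊓ L.U j ⊓ L.U l) by
          rw [preimage_inf, preimage_inf]))).hom.toMonoidHom)
      (L.cocycle i j l)
    rw [map_mul] at key
    rw [unit_sres_appLE, unit_sres_appLE, unit_sres_appLE]
    rw [unit_appLE_sres, unit_appLE_sres, unit_appLE_sres] at key
    exact key

/-- A global section of a line bundle: compatible local sections with respect to the
transition cocycle. -/
@[ext]
structure GlobalSec {X : Scheme.{u}} (L : LineBundle X) where
  s : ∀ i, Γ(X, L.U i)
  compat : ∀ i j, sres X (inf_le_left : L.U i ⊓ L.U j ≤ L.U i) (s i)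
    = (L.t i j : Γ(X, L.U i ⊓ L.U j)) * sres X inf_le_right (s j)

/-- The open locus where a global section of a line bundle does not vanish. -/
def GlobalSec.locus {X : Scheme.{u}} {L : LineBundle X} (σ : GlobalSec L) : X.Opens :=
  ⨆ i, X.basicOpen (σ.s i)

/-- A line bundle `L` on a scheme `X` is ample if `X` is quasi-compact and every point has
an affine neighbourhood of the form `X_s` for a global section `s` of some positive tensor
power of `L`. -/
def IsAmple {X : Scheme.{u}} (L : LineBundle X) : Prop :=
  CompactSpace X ∧ ∀ x : X, ∃ (m : ℕ) (_ : 0 < m) (σ : GlobalSec (L.pow m)),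
    x ∈ σ.locus ∧ IsAffineOpen σ.locus

/-- Two line bundles are isomorphic iff on a common refinement of their trivialising covers
their transition cocycles differ by a coboundary. -/
def EquivLB {X : Scheme.{u}} (L M : LineBundle X) : Prop :=
  ∃ (κ : Type u) (V : κ → X.Opens) (_ : iSup V = ⊤) (a : κ → L.ι) (b : κ → M.ι)
    (ha : ∀ c, V c ≤ L.U (a c)) (hb : ∀ c, V c ≤ M.U (b c)) (s : ∀ c, (Γ(X, V c))ˣ),
    ∀ c c' : κ,
      Units.map (sres X (le_inf ((inf_le_left.trans (ha c)))
          (inf_le_right.trans (ha c')) : V c ⊓ V c' ≤ L.U (a c) ⊓ L.U (a c'))).toMonoidHom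
          (L.t (a c) (a c'))
        * Units.map (sres X (inf_le_right : V c ⊓ V c' ≤ V c')).toMonoidHom (s c')
      = Units.map (sres X (inf_le_left : V c ⊓ V c' ≤ V c)).toMonoidHom (s c)
        * Units.map (sres X (le_inf ((inf_le_left.trans (hb c)))
            (inf_le_right.trans (hb c')))).toMonoidHom (M.t (b c) (b c'))

/-- The canonical algebra map `k → Γ(X, U)` for a scheme `X` over `Spec k`. -/
def toSections {k : Type u} [Field k] {X : Scheme.{u}} (sX : X ⟶ Spec (CommRingCat.of k))
    (U : X.Opens) : k →+* Γ(X, U) :=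
  ((sres X (le_top : U ≤ ⊤)).comp
    ((sX.appTop.hom : Γ(Spec (CommRingCat.of k), ⊤) →+* Γ(X, ⊤)))).comp
    ((Scheme.ΓSpecIso (CommRingCat.of k)).inv : CommRingCat.of k ⟶ _).hom

lemma sres_toSections {k : Type u} [Field k] {X : Scheme.{u}}
    (sX : X ⟶ Spec (CommRingCat.of k)) {V U : X.Opens} (h : V ≤ U) (c : k) :
    sres X h (toSections sX U c) = toSections sX V c := by
  simp only [toSections, RingHom.comp_apply, sres_sres]

/-- The space of global sections of a line bundle on a scheme over `k`, as a `k`-submodule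
of the product of the local section spaces. -/
def secSubmodule {k : Type u} [Field k] {X : Scheme.{u}} (sX : X ⟶ Spec (CommRingCat.of k))
    (L : LineBundle X) :
    letI : ∀ i, Module k Γ(X, L.U i) := fun i => (toSections sX (L.U i)).toModule
    Submodule k (∀ i, Γ(X, L.U i)) :=
  letI : ∀ i, Module k Γ(X, L.U i) := fun i => (toSections sX (L.U i)).toModule
  { carrier := {s | ∀ i j, sres X (inf_le_left : L.U i ⊓ L.U j ≤ L.U i) (s i)
      = (L.t i j : Γ(X, L.U i ⊓ L.U j)) * sres X inf_le_right (s j)}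
    add_mem' := by
      intro s r hs hr i j
      simp only [Pi.add_apply, map_add, hs i j, hr i j, mul_add]
    zero_mem' := by
      intro i j
      simp
    smul_mem' := by
      intro c s hs i j
      show sres X _ (toSections sX (L.U i) c * s i)
        = (L.t i j : Γ(X, L.U i ⊓ L.U j)) * sres X _ (toSections sX (L.U j) c * s j)
      rw [map_mul, map_mul, hs i j, sres_toSections, sres_toSections]
      ring }

/-- The dimension `h⁰(X, L)` of the space of global sections of a line bundle on a scheme
over a field `k`. -/
def h0 {k : Type u} [Field k] {X : Scheme.{u}} (sX : X ⟶ Spec (CommRingCat.of k))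
    (L : LineBundle X) : ℕ :=
  letI : ∀ i, Module k Γ(X, L.U i) := fun i => (toSections sX (L.U i)).toModule
  Module.finrank k (secSubmodule sX L)

lemma sres_appLE (f : X ⟶ Y) {U : Y.Opens} {V V' : X.Opens} (e : V ≤ f ⁻¹ᵁ U)
    (h : V' ≤ V) (a : Γ(Y, U)) :
    sres X h (f.appLE U V e a) = f.appLE U V' (h.trans e) a := by
  rw [show f.appLE U V' (h.trans e)
      = f.appLE U V e ≫ X.presheaf.map (homOfLE h).op from (f.appLE_map e (homOfLE h).op).symm]
  rfl

lemma appLE_sres (f : X ⟶ Y) {U U' : Y.Opens} {V : X.Opens} (e : V ≤ f ⁻¹ᵁ U)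
    (h : U ≤ U') (a : Γ(Y, U')) :
    f.appLE U V e (sres Y h a) = f.appLE U' V (e.trans (preimage_mono f h)) a := by
  rw [show f.appLE U' V (e.trans (preimage_mono f h))
      = Y.presheaf.map (homOfLE h).op ≫ f.appLE U V e from (f.map_appLE e (homOfLE h).op).symm]
  rfl

/-- Pullback of global sections of a line bundle. -/
def pullbackSec (f : X ⟶ Y) (L : LineBundle Y) (σ : GlobalSec L) :
    GlobalSec (pullbackLB f L) where
  s i := f.app (L.U i) (σ.s i)
  compat i j := by
    have key := congrArg (f.appLE (L.U i ⊓ L.U j)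
      (f ⁻¹ᵁ L.U i ⊓ f ⁻¹ᵁ L.U j) (preimage_inf f (L.U i) (L.U j)).ge) (σ.compat i j)
    rw [map_mul, appLE_sres, appLE_sres] at key
    exact key

end LineBundle

attribute [local instance] MvPolynomial.gradedAlgebra

/-- Projective `N`-space over `k`, as the `Proj` of the polynomial ring in `N + 1`
variables with its standard grading. -/
def ProjSpace (k : Type u) [Field k] (N : ℕ) : Scheme.{u} :=
  Proj (MvPolynomial.homogeneousSubmodule (Fin (N + 1)) k)

/-- The inclusion of `k` into the degree-zero part of the polynomial ring. -/
def degreeZeroInclusion (k : Type u) [Field k] (N : ℕ) :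
    k →+* (MvPolynomial.homogeneousSubmodule (Fin (N + 1)) k 0) where
  toFun c := ⟨MvPolynomial.C c, by
    simp [MvPolynomial.mem_homogeneousSubmodule, MvPolynomial.isHomogeneous_C]⟩
  map_one' := by ext; simp
  map_mul' x y := by ext; simp
  map_zero' := by ext; simp
  map_add' x y := by ext; simp

/-- The structure morphism of projective space over `k`. -/
def ProjSpace.str (k : Type u) [Field k] (N : ℕ) :
    ProjSpace k N ⟶ Spec (CommRingCat.of k) :=
  Proj.toSpecZero _ ≫ Spec.map (CommRingCat.ofHom (degreeZeroInclusion k N))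

/-- A scheme over `k` is a projective variety if it is integral and admits a closed
immersion into some projective space over `k`, compatibly with the structure morphisms. -/
def IsProjectiveVariety {k : Type u} [Field k] {X : Scheme.{u}}
    (sX : X ⟶ Spec (CommRingCat.of k)) : Prop :=
  IsIntegral X ∧ ∃ (N : ℕ) (ι : X ⟶ ProjSpace k N),
    IsClosedImmersion ι ∧ ι ≫ ProjSpace.str k N = sX

/-- The `n`-th iterate of a self-morphism of a scheme. -/
def morphIter {X : Scheme.{u}} (φ : X ⟶ X) : ℕ → (X ⟶ X) :=
  Nat.rec (𝟙 X) (fun _ g => g ≫ φ)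

/-- The image of a section of `X` over `U` in the stalk of `W` at `w`, along `g : W ⟶ X`. -/
def pullbackGerm {W X : Scheme.{u}} (g : W ⟶ X) (w : W) (U : X.Opens) (h : g w ∈ U) :
    Γ(X, U) →+* W.presheaf.stalk w :=
  (g.app U ≫ W.presheaf.germ (g ⁻¹ᵁ U) w h).hom

lemma pullbackGerm_sres {W X : Scheme.{u}} (g : W ⟶ X) (w : W) {U V : X.Opens} (hVU : V ≤ U)
    (h : g w ∈ V) (a : Γ(X, U)) :
    pullbackGerm g w V h (sres X hVU a) = pullbackGerm g w U (hVU h) a := by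
  have := g.naturality_assoc (homOfLE hVU).op (W.presheaf.germ (g ⁻¹ᵁ V) w h)
  have h2 : W.presheaf.map ((TopologicalSpace.Opens.map g.base).map (homOfLE hVU)).op ≫
    W.presheaf.germ (g ⁻¹ᵁ V) w h = W.presheaf.germ (g ⁻¹ᵁ U) w (hVU h) :=
      W.presheaf.germ_res _ _ _
  exact ConcreteCategory.congr_hom (this.trans (congrArg (fun m => g.app U ≫ m) h2)) a

lemma pullbackGerm_appLE {W X Y : Scheme.{u}} (g : W ⟶ X) (φ : X ⟶ Y) (w : W) {U : Y.Opens}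
    {V : X.Opens} (hVU : V ≤ φ ⁻¹ᵁ U) (h : g w ∈ V) (a : Γ(Y, U)) :
    pullbackGerm g w V h (φ.appLE U V hVU a) =
      pullbackGerm (g ≫ φ) w U (by simpa using hVU h) a := by
  have h1 : φ.appLE U V hVU a = sres X hVU (φ.app U a) := rfl
  rw [h1, pullbackGerm_sres]
  simp [pullbackGerm]

lemma pullbackGerm_stalkSpecializes {W X : Scheme.{u}} (g : W ⟶ X) {w v : W} (hvw : v ⤳ w)
    {U : X.Opens} (h : g w ∈ U) (a : Γ(X, U)) :
    (W.presheaf.stalkSpecializes hvw).hom (pullbackGerm g w U h a) =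
      pullbackGerm g v U ((hvw.map g.continuous).mem_open U.2 h) a := by
  have := W.presheaf.germ_stalkSpecializes (U := g ⁻¹ᵁ U) (y := w) h hvw
  exact ConcreteCategory.congr_hom this (g.app U a)

lemma isUnit_pullbackGerm_iff {W X : Scheme.{u}} (g : W ⟶ X) (w : W)
    {U : X.Opens} (h : g w ∈ U) (a : Γ(X, U)) :
    IsUnit (pullbackGerm g w U h a) ↔ g w ∈ X.basicOpen a := by
  rw [X.mem_basicOpen a _ h, ← isUnit_map_iff (g.stalkMap w).hom]
  have := g.germ_stalkMap_apply U w h a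
  exact iff_of_eq (congrArg IsUnit this.symm)

namespace LineBundle

variable {W X : Scheme.{u}}

/-- The germ at `w` of the pullback along `g` of a transition unit of `L`. -/
def transGerm (L : LineBundle X) (g : W ⟶ X) (w : W) (i j : L.ι) (hi : g w ∈ L.U i)
    (hj : g w ∈ L.U j) : W.presheaf.stalk w :=
  pullbackGerm g w (L.U i ⊓ L.U j) (TopologicalSpace.Opens.mem_inf.mpr ⟨hi, hj⟩) (L.t i j).val

lemma isUnit_transGerm (L : LineBundle X) (g : W ⟶ X) (w : W) (i j : L.ι) (hi : g w ∈ L.U i)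
    (hj : g w ∈ L.U j) : IsUnit (L.transGerm g w i j hi hj) :=
  (L.t i j).isUnit.map _

lemma transGerm_pow (L : LineBundle X) (m : ℕ) (g : W ⟶ X) (w : W) (i j : L.ι) (hi : g w ∈ L.U i)
    (hj : g w ∈ L.U j) : (L.pow m).transGerm g w i j hi hj = L.transGerm g w i j hi hj ^ m :=
  map_pow (pullbackGerm g w (L.U i ⊓ L.U j) (TopologicalSpace.Opens.mem_inf.mpr ⟨hi, hj⟩))
    (L.t i j).val m

lemma transGerm_dual_mul (L : LineBundle X) (g : W ⟶ X) (w : W) (i j : L.ι) (hi : g w ∈ L.U i)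
    (hj : g w ∈ L.U j) :
    L.dual.transGerm g w i j hi hj * L.transGerm g w i j hi hj = 1 := by
  have h := TopologicalSpace.Opens.mem_inf.mpr ⟨hi, hj⟩
  refine (map_mul (pullbackGerm g w (L.U i ⊓ L.U j) h) ((L.t i j)⁻¹).val (L.t i j).val).symm.trans
    ?_
  rw [Units.inv_mul, map_one]

lemma mem_pullbackLB_U {Y : Scheme.{u}} {L : LineBundle Y} {φ : X ⟶ Y} {g : W ⟶ X} {w : W}
    {i : L.ι} (hi : (g ≫ φ) w ∈ L.U i) : g w ∈ (pullbackLB φ L).U i := by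
  change φ (g w) ∈ L.U i
  simpa using hi

lemma transGerm_pullback {Y : Scheme.{u}} (L : LineBundle Y) (φ : X ⟶ Y) (g : W ⟶ X) (w : W)
    (i j : L.ι) (hi : g w ∈ φ ⁻¹ᵁ L.U i) (hj : g w ∈ φ ⁻¹ᵁ L.U j) :
    (pullbackLB φ L).transGerm g w i j hi hj =
      L.transGerm (g ≫ φ) w i j (by simpa using hi) (by simpa using hj) :=
  pullbackGerm_appLE g φ w _ _ _

lemma transGerm_tensor (L M : LineBundle X) (g : W ⟶ X) (w : W) (i j : L.ι) (k l : M.ι)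
    (hi : g w ∈ L.U i) (hj : g w ∈ L.U j) (hk : g w ∈ M.U k) (hl : g w ∈ M.U l) :
    (L.tensor M).transGerm g w (i, k) (j, l) (TopologicalSpace.Opens.mem_inf.mpr ⟨hi, hk⟩)
        (TopologicalSpace.Opens.mem_inf.mpr ⟨hj, hl⟩) =
      L.transGerm g w i j hi hj * M.transGerm g w k l hk hl := by
  have h := TopologicalSpace.Opens.mem_inf.mpr
    ⟨TopologicalSpace.Opens.mem_inf.mpr ⟨hi, hk⟩, TopologicalSpace.Opens.mem_inf.mpr ⟨hj, hl⟩⟩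
  refine (map_mul (pullbackGerm g w ((L.U i ⊓ M.U k) ⊓ (L.U j ⊓ M.U l)) h)
    (sres X _ (L.t i j).val) (sres X _ (M.t k l).val)).trans ?_
  rw [pullbackGerm_sres, pullbackGerm_sres]
  rfl

lemma pullbackGerm_compat {L : LineBundle X} (σ : GlobalSec L) (g : W ⟶ X)
    (w : W) {i j : L.ι} (hi : g w ∈ L.U i) (hj : g w ∈ L.U j) :
    pullbackGerm g w (L.U i) hi (σ.s i) =
      L.transGerm g w i j hi hj * pullbackGerm g w (L.U j) hj (σ.s j) := by
  rw [← pullbackGerm_sres g w inf_le_left (TopologicalSpace.Opens.mem_inf.mpr ⟨hi, hj⟩),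
    ← pullbackGerm_sres g w inf_le_right (TopologicalSpace.Opens.mem_inf.mpr ⟨hi, hj⟩),
    transGerm, ← map_mul, ← σ.compat i j]

lemma isUnit_pullbackGerm_iff_mem_locus {L : LineBundle X} (σ : GlobalSec L)
    (g : W ⟶ X) (w : W) (i : L.ι) (hi : g w ∈ L.U i) :
    IsUnit (pullbackGerm g w (L.U i) hi (σ.s i)) ↔ g w ∈ σ.locus := by
  refine ⟨fun h => TopologicalSpace.Opens.mem_iSup.mpr
    ⟨i, (isUnit_pullbackGerm_iff g w hi _).mp h⟩, fun hw => ?_⟩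
  obtain ⟨j, hj⟩ := TopologicalSpace.Opens.mem_iSup.mp hw
  have hjU : g w ∈ L.U j := X.basicOpen_le _ hj
  rw [← isUnit_pullbackGerm_iff g w hjU] at hj
  rw [pullbackGerm_compat σ g w hi hjU]
  exact (L.isUnit_transGerm g w i j hi hjU).mul hj

variable (φ : X ⟶ X) (L : LineBundle X) {m : ℕ}

/-- The germ at `w` of the pullback along `g` of a section of a power of `φ*L ⊗ L⁻¹`, read in the
trivialisations of `φ*L` and `L` with indices `a` and `b`. -/
def secGerm (σ : GlobalSec (((pullbackLB φ L).tensor L.dual).pow m)) (g : W ⟶ X) (w : W)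
    (a b : L.ι) (ha : (g ≫ φ) w ∈ L.U a) (hb : g w ∈ L.U b) : W.presheaf.stalk w :=
  pullbackGerm g w ((((pullbackLB φ L).tensor L.dual).pow m).U (a, b))
    (TopologicalSpace.Opens.mem_inf.mpr ⟨mem_pullbackLB_U ha, hb⟩) (σ.s (a, b))

lemma secGerm_stalkSpecializes (σ : GlobalSec (((pullbackLB φ L).tensor L.dual).pow m))
    (g : W ⟶ X) {w v : W} (hvw : v ⤳ w) (a b : L.ι) (ha : (g ≫ φ) w ∈ L.U a)
    (hb : g w ∈ L.U b) :
    (W.presheaf.stalkSpecializes hvw).hom (secGerm φ L σ g w a b ha hb) =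
      secGerm φ L σ g v a b ((hvw.map (g ≫ φ).continuous).mem_open (L.U a).2 ha)
        ((hvw.map g.continuous).mem_open (L.U b).2 hb) :=
  pullbackGerm_stalkSpecializes g hvw _ _

lemma isUnit_secGerm_iff (σ : GlobalSec (((pullbackLB φ L).tensor L.dual).pow m))
    (g : W ⟶ X) (w : W) (a b : L.ι) (ha : (g ≫ φ) w ∈ L.U a) (hb : g w ∈ L.U b) :
    IsUnit (secGerm φ L σ g w a b ha hb) ↔ g w ∈ σ.locus :=
  isUnit_pullbackGerm_iff_mem_locus σ g w _ _

/-- Change of trivialisation for `secGerm`. -/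
lemma transGerm_mul_secGerm (σ : GlobalSec (((pullbackLB φ L).tensor L.dual).pow m))
    (g : W ⟶ X) (w : W) (a b a' b' : L.ι) (ha : (g ≫ φ) w ∈ L.U a) (hb : g w ∈ L.U b)
    (ha' : (g ≫ φ) w ∈ L.U a') (hb' : g w ∈ L.U b') :
    L.transGerm g w b b' hb hb' ^ m * secGerm φ L σ g w a b ha hb =
      L.transGerm (g ≫ φ) w a a' ha ha' ^ m * secGerm φ L σ g w a' b' ha' hb' := by
  have h1 : secGerm φ L σ g w a b ha hb = _ * secGerm φ L σ g w a' b' ha' hb' :=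
    pullbackGerm_compat σ g w _ _
  have h2 := transGerm_pow ((pullbackLB φ L).tensor L.dual) m g w (a, b) (a', b')
    (TopologicalSpace.Opens.mem_inf.mpr ⟨mem_pullbackLB_U ha, hb⟩)
    (TopologicalSpace.Opens.mem_inf.mpr ⟨mem_pullbackLB_U ha', hb'⟩)
  have h3 := transGerm_tensor (pullbackLB φ L) L.dual g w a a' b b'
    (mem_pullbackLB_U ha) (mem_pullbackLB_U ha') hb hb'
  have h4 := transGerm_pullback L φ g w a a' (mem_pullbackLB_U ha) (mem_pullbackLB_U ha')
  rw [h4] at h3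
  rw [h1, h2.trans (congrArg (· ^ m) h3), ← mul_assoc]
  congr 1
  have h5 := L.transGerm_dual_mul g w b b' hb hb'
  rw [← mul_pow]
  congr 1
  rw [mul_comm, mul_assoc, h5, mul_one]

end LineBundle

/-- The composite of `i : W ⟶ X` with the `j`-th iterate of `φ : X ⟶ X`. -/
def compIter {W X : Scheme.{u}} (i : W ⟶ X) (φ : X ⟶ X) : ℕ → (W ⟶ X)
  | 0 => i
  | j + 1 => compIter i φ j ≫ φ

lemma compIter_eq {W X : Scheme.{u}} (i : W ⟶ X) (φ : X ⟶ X) (j : ℕ) :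
    compIter i φ j = i ≫ morphIter φ j := by
  induction j with
  | zero => exact (Category.comp_id i).symm
  | succ j ih =>
    change compIter i φ j ≫ φ = i ≫ (morphIter φ j ≫ φ)
    rw [ih, Category.assoc]

namespace LineBundle

variable {W X : Scheme.{u}}

lemma transGerm_congr (L : LineBundle X) {g g' : W ⟶ X} (hg : g = g') (w : W) {i j i' j' : L.ι}
    (hi : i = i') (hj : j = j') (h₁ : g w ∈ L.U i) (h₂ : g w ∈ L.U j) (h₁' : g' w ∈ L.U i')
    (h₂' : g' w ∈ L.U j') : L.transGerm g w i j h₁ h₂ = L.transGerm g' w i' j' h₁' h₂' := by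
  subst hg hi hj
  rfl

lemma exists_mem_U (L : LineBundle X) (x : X) : ∃ i, x ∈ L.U i := by
  have : x ∈ iSup L.U := by rw [L.covers]; trivial
  exact TopologicalSpace.Opens.mem_iSup.mp this

variable (φ : X ⟶ X) (L : LineBundle X) {m : ℕ → ℕ}

/-- The germ at `w` of the product of (powers of) the pullbacks along `i ≫ φ ^ j`, `j < n`, of
sections of powers of `φ*L ⊗ L⁻¹`. -/
def normGerm (σ : ∀ j, GlobalSec (((pullbackLB φ L).tensor L.dual).pow (m j))) (e : ℕ → ℕ)
    (n : ℕ) (i : W ⟶ X) (w : W) (β : ℕ → L.ι) (hβ : ∀ j, compIter i φ j w ∈ L.U (β j)) :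
    W.presheaf.stalk w :=
  ∏ j ∈ Finset.range n,
    secGerm φ L (σ j) (compIter i φ j) w (β (j + 1)) (β j) (hβ (j + 1)) (hβ j) ^ e j

lemma normGerm_stalkSpecializes
    (σ : ∀ j, GlobalSec (((pullbackLB φ L).tensor L.dual).pow (m j))) (e : ℕ → ℕ)
    (n : ℕ) (i : W ⟶ X) {w v : W} (hvw : v ⤳ w) (β : ℕ → L.ι)
    (hβ : ∀ j, compIter i φ j w ∈ L.U (β j)) :
    (W.presheaf.stalkSpecializes hvw).hom (normGerm φ L σ e n i w β hβ) =
      normGerm φ L σ e n i v β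
        (fun j => (hvw.map (compIter i φ j).continuous).mem_open (L.U (β j)).2 (hβ j)) := by
  simp only [normGerm, map_prod, map_pow]
  exact Finset.prod_congr rfl fun j _ => congrArg (· ^ e j)
    (secGerm_stalkSpecializes _ _ _ _ _ _ _ _ _)

/-- If `i ≫ φ ^ n = i`, the product defining `normGerm` is a section of the trivial bundle: it does
not depend on the chosen trivialisations. -/
lemma normGerm_eq (σ : ∀ j, GlobalSec (((pullbackLB φ L).tensor L.dual).pow (m j)))
    (e : ℕ → ℕ) (n N : ℕ) (hN : ∀ j < n, m j * e j = N) (i : W ⟶ X)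
    (hi : compIter i φ n = i) (w : W) (β β' : ℕ → L.ι)
    (hβ : ∀ j, compIter i φ j w ∈ L.U (β j)) (hβ' : ∀ j, compIter i φ j w ∈ L.U (β' j))
    (hn : β n = β 0) (hn' : β' n = β' 0) :
    normGerm φ L σ e n i w β hβ = normGerm φ L σ e n i w β' hβ' := by
  set τ : ℕ → W.presheaf.stalk w :=
    fun j => L.transGerm (compIter i φ j) w (β j) (β' j) (hβ j) (hβ' j) ^ N with hτ
  have hunit : ∀ j, IsUnit (τ j) := fun j => (L.isUnit_transGerm _ _ _ _ _ _).pow N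
  have hτn : τ n = τ 0 := congrArg (· ^ N) (L.transGerm_congr hi w hn hn' _ _ _ _)
  have hprod : ∏ j ∈ Finset.range n, τ (j + 1) = ∏ j ∈ Finset.range n, τ j := by
    apply (hunit 0).mul_right_cancel
    rw [← Finset.prod_range_succ', Finset.prod_range_succ, hτn]
  have key : (∏ j ∈ Finset.range n, τ j) * normGerm φ L σ e n i w β hβ =
      (∏ j ∈ Finset.range n, τ (j + 1)) * normGerm φ L σ e n i w β' hβ' := by
    rw [normGerm, normGerm, ← Finset.prod_mul_distrib, ← Finset.prod_mul_distrib]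
    refine Finset.prod_congr rfl fun j hj => ?_
    have := congrArg (· ^ e j) (transGerm_mul_secGerm φ L (σ j) (compIter i φ j) w (β (j + 1))
      (β j) (β' (j + 1)) (β' j) (hβ (j + 1)) (hβ j) (hβ' (j + 1)) (hβ' j))
    simp only [mul_pow, ← pow_mul, hN j (Finset.mem_range.mp hj)] at this
    exact this
  rw [hprod] at key
  exact (IsUnit.prod_iff.mpr fun j _ => hunit (j + 1)).mul_left_cancel (hprod ▸ key)

end LineBundle

/-- A rational function on an integral scheme that is regular at each point is a global section. -/
lemma exists_germToFunctionField_eq {W : Scheme.{u}} [IsIntegral W] (f : W.functionField)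
    (hf : ∀ w : W, ∃ a : W.presheaf.stalk w,
      (W.presheaf.stalkSpecializes (genericPoint_specializes w)).hom a = f) :
    ∃ s : Γ(W, ⊤), ∀ w : W, ∀ a : W.presheaf.stalk w,
      (W.presheaf.stalkSpecializes (genericPoint_specializes w)).hom a = f →
        W.presheaf.germ ⊤ w trivial s = a := by
  have hinj : ∀ w : W, Function.Injective
      (W.presheaf.stalkSpecializes (genericPoint_specializes w)).hom := fun w =>
    IsFractionRing.injective (W.presheaf.stalk w) W.functionField
  choose a ha using hf
  choose U hU b hb using fun w => W.presheaf.exists_germ_eq (a w)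
  have hη : ∀ w, genericPoint W ∈ U w := fun w =>
    (genericPoint_specializes w).mem_open (U w).2 (hU w)
  have hbη : ∀ w, W.presheaf.germ (U w) (genericPoint W) (hη w) (b w) = f := fun w => by
    rw [← ha w, ← hb w]
    exact (ConcreteCategory.congr_hom
      (W.presheaf.germ_stalkSpecializes (hU w) (genericPoint_specializes w)) (b w)).symm
  obtain ⟨s, hs, -⟩ := W.sheaf.existsUnique_gluing' U ⊤ (fun w => homOfLE le_top)
    (fun w _ => TopologicalSpace.Opens.mem_iSup.mpr ⟨w, hU w⟩) b (by
      intro w v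
      have hmem : genericPoint W ∈ U w ⊓ U v :=
        TopologicalSpace.Opens.mem_inf.mpr ⟨hη w, hη v⟩
      apply germ_injective_of_isIntegral W (genericPoint W) hmem
      refine (W.presheaf.germ_res_apply _ _ _ _).trans
        (Eq.trans ?_ (W.presheaf.germ_res_apply _ _ _ _).symm)
      exact (hbη w).trans (hbη v).symm)
  refine ⟨s, fun w c hc => hinj w ?_⟩
  rw [hc, ← ha w, ← hb w, ← hs w]
  congr 1
  exact (W.presheaf.germ_res_apply _ _ _ _).symm

/-- An affine integral scheme that is universally closed over a field is a single point. -/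
lemma subsingleton_of_isAffine_of_universallyClosed {K : Type u} [Field K] {W : Scheme.{u}}
    [IsIntegral W] [IsAffine W] (f : W ⟶ Spec (CommRingCat.of K)) [UniversallyClosed f] :
    Subsingleton W := by
  let := (isField_of_universallyClosed K f).toField
  have : Subsingleton (Spec Γ(W, ⊤)) :=
    inferInstanceAs (Subsingleton (PrimeSpectrum Γ(W, ⊤)))
  exact W.isoSpec.hom.homeomorph.injective.subsingleton

lemma subsingleton_of_compIter_eq {K : Type u} [Field K] {W X : Scheme.{u}} [IsIntegral W]
    (sW : W ⟶ Spec (CommRingCat.of K)) [UniversallyClosed sW] (i : W ⟶ X) [IsAffineHom i]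
    (φ : X ⟶ X) (L : LineBundle X)
    (hL : ((LineBundle.pullbackLB φ L).tensor L.dual).IsAmple) {n : ℕ} (hn : 0 < n)
    (hi : compIter i φ n = i) : Subsingleton W := by
  obtain ⟨x⟩ : Nonempty W := inferInstance
  choose m hm σ hσ haff using fun j : ℕ => hL.2 (compIter i φ j x)
  choose α hα using L.exists_mem_U
  let N := ∏ j ∈ Finset.range n, m j
  let e : ℕ → ℕ := fun j => N / m j
  have hN : ∀ j < n, m j * e j = N := fun j hj =>
    Nat.mul_div_cancel' (Finset.dvd_prod_of_mem m (Finset.mem_range.mpr hj))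
  have hNpos : 0 < N := Finset.prod_pos fun j _ => hm j
  let β : W → ℕ → L.ι := fun w j => α (compIter i φ j w)
  have hβ : ∀ w j, compIter i φ j w ∈ L.U (β w j) := fun w j => hα _
  have hβn : ∀ w, β w n = β w 0 := fun w => by
    change α (compIter i φ n w) = α (i w)
    rw [hi]
  let F : ∀ w : W, W.presheaf.stalk w := fun w =>
    LineBundle.normGerm φ L σ e n i w (β w) (hβ w)
  have hF : ∀ w, (W.presheaf.stalkSpecializes (genericPoint_specializes w)).hom (F w) =
      F (genericPoint W) := fun w => by
    rw [LineBundle.normGerm_stalkSpecializes]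
    exact LineBundle.normGerm_eq φ L σ e n N hN i hi _ _ _ _ _ (hβn _) (hβn _)
  obtain ⟨s, hs⟩ := exists_germToFunctionField_eq (F (genericPoint W)) fun w => ⟨F w, hF w⟩
  have hFx : IsUnit (F x) := IsUnit.prod_iff.mpr fun j _ =>
    ((LineBundle.isUnit_secGerm_iff φ L (σ j) _ _ _ _ _ _).mpr (hσ j)).pow _
  have hs0 : s ≠ 0 := by
    rintro rfl
    rw [← hs x _ (hF x), map_zero] at hFx
    exact not_isUnit_zero hFx
  have hsu : IsUnit s := by
    obtain ⟨t, ht⟩ := (isField_of_universallyClosed K sW).mul_inv_cancel hs0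
    exact IsUnit.of_mul_eq_one t ht
  have hloc : ∀ w, i w ∈ (σ 0).locus := fun w => by
    have hFw : IsUnit (F w) := by
      rw [← hs w _ (hF w)]
      exact hsu.map _
    have h0 := IsUnit.prod_iff.mp hFw 0 (Finset.mem_range.mpr hn)
    rw [isUnit_pow_iff (fun h => by have := hN 0 hn; simp_all)] at h0
    exact (LineBundle.isUnit_secGerm_iff φ L (σ 0) _ _ _ _ _ _).mp h0
  have htop : i ⁻¹ᵁ (σ 0).locus = ⊤ := by
    ext w
    simpa using hloc w
  have : IsAffine W := by
    have := (haff 0).preimage i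
    rw [htop] at this
    have : IsAffine (⊤ : W.Opens) := this
    exact .of_isIso W.topIso.inv
  exact subsingleton_of_isAffine_of_universallyClosed sW

lemma isIntegral_image {X Y : Scheme.{u}} (f : X ⟶ Y) [QuasiCompact f] [IsIntegral X] :
    IsIntegral f.image where
  nonempty := ⟨f.toImage (genericPoint X)⟩
  component_integral U hU := by
    obtain ⟨u⟩ := hU
    obtain ⟨x, hx⟩ := f.toImage.denseRange.exists_mem_open U.2 ⟨u.1, u.2⟩
    have : Nonempty (f.toImage ⁻¹ᵁ U) := ⟨⟨x, hx⟩⟩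
    have hinj := (TopCat.Presheaf.app_injective_iff_stalkFunctor_map_injective
      (F := f.image.sheaf) f.toImage.c).mp (f.stalkFunctor_toImage_injective)
    have : Function.Injective (f.toImage.app U).hom := hinj U
    exact this.isDomain (f.toImage.app U).hom

lemma degreeZeroInclusion_surjective (k : Type u) [Field k] (N : ℕ) :
    Function.Surjective (degreeZeroInclusion k N) := by
  rintro ⟨p, hp⟩
  rw [MvPolynomial.mem_homogeneousSubmodule, ← MvPolynomial.totalDegree_zero_iff_isHomogeneous,
    MvPolynomial.totalDegree_eq_zero_iff_eq_C] at hp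
  exact ⟨_, Subtype.ext hp.symm⟩

instance isProper_projSpace_str (k : Type u) [Field k] (N : ℕ) : IsProper (ProjSpace.str k N) := by
  have : IsClosedImmersion (Spec.map (CommRingCat.ofHom (degreeZeroInclusion k N))) :=
    IsClosedImmersion.spec_of_surjective _ (degreeZeroInclusion_surjective k N)
  have : Algebra.FiniteType (MvPolynomial.homogeneousSubmodule (Fin (N + 1)) k 0)
      (MvPolynomial (Fin (N + 1)) k) := by
    have h : ((algebraMap (MvPolynomial.homogeneousSubmodule (Fin (N + 1)) k 0)
        (MvPolynomial (Fin (N + 1)) k)).comp (degreeZeroInclusion k N)).FiniteType :=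
      (RingHom.finiteType_algebraMap (A := k) (B := MvPolynomial (Fin (N + 1)) k)).mpr inferInstance
    exact RingHom.finiteType_algebraMap.mp h.of_comp_finiteType
  have hProj : IsProper (Proj.toSpecZero (MvPolynomial.homogeneousSubmodule (Fin (N + 1)) k)) :=
    inferInstance
  exact MorphismProperty.comp_mem @IsProper _ _ hProj inferInstance

lemma IsProjectiveVariety.isProper {k : Type u} [Field k] {X : Scheme.{u}}
    {sX : X ⟶ Spec (CommRingCat.of k)} (hX : IsProjectiveVariety sX) : IsProper sX := by
  obtain ⟨-, N, ι, hι, rfl⟩ := hX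
  infer_instance

lemma morphIter_comp {S X : Scheme.{u}} {φ : X ⟶ X} {s : X ⟶ S} (h : φ ≫ s = s) (n : ℕ) :
    morphIter φ n ≫ s = s := by
  induction n with
  | zero => exact Category.id_comp s
  | succ n ih =>
    change (morphIter φ n ≫ φ) ≫ s = s
    rw [Category.assoc, h, ih]

/-- A closed point fixed by an endomorphism of a scheme over an algebraically closed field lies in
the scheme-theoretic fixed locus. -/
lemma mem_range_equalizer_ι {K : Type u} [Field K] [IsAlgClosed K] {X : Scheme.{u}}
    (sX : X ⟶ Spec (CommRingCat.of K)) [LocallyOfFiniteType sX] {ψ : X ⟶ X} (hψ : ψ ≫ sX = sX)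
    {x : X} (hx : IsClosed ({x} : Set X)) (hfix : ψ x = x) :
    x ∈ Set.range (equalizer.ι ψ (𝟙 X)) := by
  let p := pointOfClosedPoint sX x hx
  have hp : p ≫ ψ = p ≫ 𝟙 X := by
    refine ext_of_apply_closedPoint_eq sX ?_ ?_ ?_
    · simp [p, hψ]
    · simp [p]
    · have key : ∀ y : Spec (CommRingCat.of K), (p ≫ ψ) y = (p ≫ 𝟙 X) y := fun y => by
        rw [Category.comp_id, Scheme.Hom.comp_apply, pointOfClosedPoint_apply sX x hx, hfix]
      exact key _
  obtain ⟨y⟩ : Nonempty (Spec (CommRingCat.of K)) := inferInstance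
  refine ⟨equalizer.lift p hp y, ?_⟩
  rw [← Scheme.Hom.comp_apply, equalizer.lift_ι]
  exact pointOfClosedPoint_apply sX x hx y

lemma finite_of_noetherianSpace_of_t1Space {Z : Type*} [TopologicalSpace Z]
    [TopologicalSpace.NoetherianSpace Z] [QuasiSober Z] [T1Space Z] : Finite Z := by
  have hfin : (irreducibleComponents Z).Finite :=
    TopologicalSpace.NoetherianSpace.finite_irreducibleComponents
  have hinj : Function.Injective (fun z : Z => irreducibleComponent z) := by
    intro z w h
    obtain ⟨g, hg⟩ := QuasiSober.sober (isIrreducible_irreducibleComponent (x := z))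
      isClosed_irreducibleComponent
    have hg' : irreducibleComponent z = {g} := by rw [← hg, closure_singleton]
    have h1 : z ∈ irreducibleComponent z := mem_irreducibleComponent
    have h2 : w ∈ irreducibleComponent w := mem_irreducibleComponent
    simp only at h
    rw [← h] at h2
    rw [hg'] at h1 h2
    exact h1.trans h2.symm
  have := hfin.to_subtype
  exact Finite.of_injective
    (fun z : Z => (⟨irreducibleComponent z, irreducibleComponent_mem_irreducibleComponents z⟩ :
      irreducibleComponents Z)) fun z w h => hinj (congrArg Subtype.val h)

lemma isClosed_singleton_of_fixed {K : Type u} [Field K] {Z X : Scheme.{u}} [IsNoetherian Z]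
    (sZ : Z ⟶ Spec (CommRingCat.of K)) [UniversallyClosed sZ] (j : Z ⟶ X) [IsAffineHom j]
    (φ : X ⟶ X) (L : LineBundle X)
    (hL : ((LineBundle.pullbackLB φ L).tensor L.dual).IsAmple) {n : ℕ} (hn : 0 < n)
    (hj : j ≫ morphIter φ n = j) (z : Z) : IsClosed ({z} : Set Z) := by
  let f := Z.fromSpecResidueField z
  have hW : IsIntegral f.image := isIntegral_image f
  have hsub : Subsingleton f.image :=
    subsingleton_of_compIter_eq (f.imageι ≫ sZ) (f.imageι ≫ j) φ L hL hn
      (by rw [compIter_eq, Category.assoc, hj])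
  have hrange : IsClosed (Set.range f.imageι) := f.imageι.isClosedEmbedding.isClosed_range
  have hz : z ∈ Set.range f.imageι := by
    obtain ⟨y⟩ : Nonempty (Spec (Z.residueField z)) := inferInstance
    refine ⟨f.toImage y, ?_⟩
    rw [← Scheme.Hom.comp_apply, f.toImage_imageι]
    exact Z.fromSpecResidueField_apply z y
  rwa [(Set.subsingleton_range f.imageι).eq_singleton_of_mem hz] at hrange

/-- Let `X` be a projective variety over an algebraically closed field `K`,
`φ : X → X` a morphism and `L` a line bundle on `X` such that `φ*(L) ⊗ L⁻¹` is ample. Then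
for every `n ≥ 1` the set of `K`-points (= closed points) fixed by `φ^n` is finite, i.e.
the intersection of the diagonal with the graph of `φ^n` has finitely many `K`-points. -/
theorem stmt_19 {K : Type u} [Field K] [IsAlgClosed K] {X : Scheme.{u}}
    (sX : X ⟶ Spec (CommRingCat.of K)) (hX : IsProjectiveVariety sX)
    (φ : X ⟶ X) (hφ : φ ≫ sX = sX)
    (L : LineBundle X)
    (hL : ((LineBundle.pullbackLB φ L).tensor L.dual).IsAmple) :
    ∀ n : ℕ, 0 < n →
      {x : X | (morphIter φ n).base x = x ∧ IsClosed ({x} : Set X)}.Finite := by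
  intro n hn
  have := hX.isProper
  let ψ := morphIter φ n
  have : X.IsSeparated := ⟨by
    rw [← terminal.comp_from sX]
    infer_instance⟩
  let Z := equalizer ψ (𝟙 X)
  let j : Z ⟶ X := equalizer.ι ψ (𝟙 X)
  have hj : j ≫ ψ = j := (equalizer.condition ψ (𝟙 X)).trans (Category.comp_id _)
  have : IsLocallyNoetherian Z := LocallyOfFiniteType.isLocallyNoetherian (j ≫ sX)
  have : CompactSpace Z := QuasiCompact.compactSpace_of_compactSpace (j ≫ sX)
  have : IsNoetherian Z := {}
  have : T1Space Z := ⟨isClosed_singleton_of_fixed (j ≫ sX) j φ L hL hn hj⟩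
  have : Finite Z := finite_of_noetherianSpace_of_t1Space
  refine (Set.finite_range j).subset fun x hx => ?_
  exact mem_range_equalizer_ι sX (morphIter_comp hφ n) hx.2 hx.1
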